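/- Let A and B be standard Young tableaux of shapes α ⊢ a and β ⊢ b respectively. Then |T_n(A,B)| / |T_n(∅,∅)| converges to f^α f^β / (a! b!) as n → ∞, where f^α is the number of standard Young tableaux of shape α and |T_n(∅,∅)| = n! is the number of pairs of same-shape standard Young tableaux of size n. -/

import Mathlib

open Finset

namespace QT

/-- The major index of a permutation of `Fin n` (sum of descents,
with positions written `1,...,n-1` as in one-line notation). -/
def maj {n : ℕ} (π : Equiv.Perm (Fin n)) : ℕ :=
  ∑ i ∈ Finset.range n,
    if h : i + 1 < n then
      (if π ⟨i + 1, h⟩ < π ⟨i, by omega⟩ then i + 1 else 0)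
    else 0

/-- `imaj π = maj π⁻¹`. -/
def imaj {n : ℕ} (π : Equiv.Perm (Fin n)) : ℕ := maj π⁻¹

/-- The permutation of `Fin k` order-isomorphic to the word `v 0, v 1, ..., v (k-1)`. -/
noncomputable def standardize {n k : ℕ} (v : Fin k → Fin n) (hv : Function.Injective v) :
    Equiv.Perm (Fin k) :=
  Equiv.ofBijective
    (fun i => (Finset.orderIsoOfFin (Finset.image v Finset.univ)
        (by rw [Finset.card_image_of_injective _ hv, Finset.card_univ, Fintype.card_fin])).symm
        ⟨v i, Finset.mem_image_of_mem v (Finset.mem_univ i)⟩)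
    (Finite.injective_iff_bijective.mp (fun i j hij => by
      have h2 := (Finset.orderIsoOfFin _ _).symm.injective hij
      exact hv (congrArg Subtype.val h2)))

/-- `π^{≤k}` : the permutation of `Fin k` order-isomorphic to the first `k` letters of `π`. -/
noncomputable def pInit {n : ℕ} (π : Equiv.Perm (Fin n)) (k : ℕ) (hk : k ≤ n) :
    Equiv.Perm (Fin k) :=
  standardize (fun i => π (Fin.castLE hk i))
    (fun i j h => Fin.castLE_injective hk (π.injective h))

/-- `π^{>k}` : the permutation of `Fin (n-k)` order-isomorphic to the last `n - k` letters of `π`. -/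
noncomputable def pTail {n : ℕ} (π : Equiv.Perm (Fin n)) (k : ℕ) :
    Equiv.Perm (Fin (n - k)) :=
  standardize (fun i => π ⟨k + (i : ℕ), by have := i.isLt; omega⟩)
    (fun i j h => by
      have h2 : k + (i : ℕ) = k + (j : ℕ) := congrArg Fin.val (π.injective h)
      exact Fin.ext (by omega))

/-- `π_{≤k}` : the permutation of `Fin k` order-isomorphic to the subword of `π`
consisting of the `k` smallest values.  (Equivalently `((π⁻¹)^{≤k})⁻¹`.) -/
noncomputable def vLow {n : ℕ} (π : Equiv.Perm (Fin n)) (k : ℕ) (hk : k ≤ n) :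
    Equiv.Perm (Fin k) := (pInit π⁻¹ k hk)⁻¹

/-- `π_{>k}` : the permutation of `Fin (n-k)` order-isomorphic to the subword of `π`
consisting of the values `> k`.  (Equivalently `((π⁻¹)^{>k})⁻¹`.) -/
noncomputable def vHigh {n : ℕ} (π : Equiv.Perm (Fin n)) (k : ℕ) :
    Equiv.Perm (Fin (n - k)) := (pTail π⁻¹ k)⁻¹

/-- The set `I_n` of involutions in `S_n`. -/
def involutions (n : ℕ) : Finset (Equiv.Perm (Fin n)) :=
  Finset.univ.filter fun π => π * π = 1

-- `I_n(σ) = {π ∈ I_n : π_{≤m} = σ}`.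
open scoped Classical in
noncomputable def involutionsC (n : ℕ) {m : ℕ} (σ : Equiv.Perm (Fin m)) :
    Finset (Equiv.Perm (Fin n)) :=
  (involutions n).filter fun π => ∃ h : m ≤ n, vLow π m h = σ

-- `S_n(σ,τ) = {π ∈ S_n : π_{≤a} = σ, π^{≤b} = τ}`.
open scoped Classical in
noncomputable def permsC (n : ℕ) {a b : ℕ} (σ : Equiv.Perm (Fin a)) (τ : Equiv.Perm (Fin b)) :
    Finset (Equiv.Perm (Fin n)) :=
  Finset.univ.filter fun π => ∃ (ha : a ≤ n) (hb : b ≤ n), vLow π a ha = σ ∧ pInit π b hb = τ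

-- The j-set `J(σ) = {j : σ^{≤j} is an involution}`.
open scoped Classical in
noncomputable def jSet {m : ℕ} (σ : Equiv.Perm (Fin m)) : Finset ℕ :=
  (Finset.range (m + 1)).filter fun j => ∃ h : j ≤ m, pInit σ j h * pInit σ j h = 1

-- The j₂-set `J(σ,τ) = {j : σ^{≤j} = τ_{≤j}}`.
open scoped Classical in
noncomputable def j2Set {a b : ℕ} (σ : Equiv.Perm (Fin a)) (τ : Equiv.Perm (Fin b)) :
    Finset ℕ :=
  (Finset.range (min a b + 1)).filter fun j =>
    ∃ (ha : j ≤ a) (hb : j ≤ b), pInit σ j ha = vLow τ j hb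

/-- A set of nonnegative integers is a j₂-set if it is `J(σ,τ)` for some pair of
permutations. -/
def IsJ2Set (S : Finset ℕ) : Prop :=
  ∃ (a b : ℕ) (σ : Equiv.Perm (Fin a)) (τ : Equiv.Perm (Fin b)), S = j2Set σ τ

-- The number of j₂-sets with largest element `n`.
open scoped Classical in
noncomputable def j2count (n : ℕ) : ℕ :=
  ((Finset.range (n + 1)).powerset.filter
    fun S => IsJ2Set S ∧ n ∈ S ∧ ∀ x ∈ S, x ≤ n).card

/-- `[n]_q = 1 + q + ⋯ + q^{n-1}`. -/
def qInt (q : ℝ) (n : ℕ) : ℝ := ∑ i ∈ Finset.range n, q ^ i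

/-- The q-factorial `[n]_q! = ∏_{i=1}^n (1 + q + ⋯ + q^{i-1})`. -/
def qFact (q : ℝ) (n : ℕ) : ℝ := ∏ i ∈ Finset.range n, qInt q (i + 1)

/-- The Gaussian binomial coefficient `[n choose k]_q = [n]_q!/([k]_q! [n-k]_q!)`,
defined via the q-Pascal recursion. -/
def qBinom (q : ℝ) : ℕ → ℕ → ℝ
  | _, 0 => 1
  | 0, _ + 1 => 0
  | n + 1, k + 1 => qBinom q n k + q ^ (k + 1) * qBinom q n (k + 1)

/-- `t_n(q) = Σ_{π ∈ I_n} q^{maj π}`. -/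
noncomputable def tq (q : ℝ) (n : ℕ) : ℝ := ∑ π ∈ involutions n, q ^ maj π

/-- `A_n(p,q) = Σ_{π ∈ S_n} p^{imaj π} q^{maj π}`. -/
noncomputable def Apq (p q : ℝ) (n : ℕ) : ℝ :=
  ∑ π : Equiv.Perm (Fin n), p ^ imaj π * q ^ maj π



/-- The `k × k` square Young diagram. -/
def square (k : ℕ) : YoungDiagram :=
  ⟨Finset.range k ×ˢ Finset.range k, by
    intro a b hab ha
    rw [Finset.mem_coe, Finset.mem_product] at ha ⊢
    simp only [Finset.mem_range] at ha ⊢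
    exact ⟨lt_of_le_of_lt hab.1 ha.1, lt_of_le_of_lt hab.2 ha.2⟩⟩

-- All Young diagrams contained in `l`.
open scoped Classical in
noncomputable def subDiagrams (l : YoungDiagram) : Finset YoungDiagram :=
  (l.cells.powerset.filter fun (s : Finset (ℕ × ℕ)) => IsLowerSet ((s : Set (ℕ × ℕ)))).attach.image
    fun s => YoungDiagram.mk s.1 (by
      have hs := s.2
      rw [Finset.mem_filter] at hs
      exact hs.2)

/-- All Young diagrams with `k` cells (i.e. partitions of `k`). -/
noncomputable def diagramsOfCard (k : ℕ) : Finset YoungDiagram :=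
  (subDiagrams (square k)).filter fun d => d.card = k

/-- A chain of Young diagrams each obtained from the previous by adding one cell.
Such chains of length `n` starting at `μ` and ending at `λ` are exactly the skew standard
Young tableaux of shape `λ/μ` with `n` cells. -/
def IsSYTChain {n : ℕ} (c : Fin (n + 1) → YoungDiagram) : Prop :=
  ∀ i : ℕ, ∀ _h : i < n,
    c ⟨i, by omega⟩ ≤ c ⟨i + 1, by omega⟩ ∧
      (c ⟨i + 1, by omega⟩).card = (c ⟨i, by omega⟩).card + 1

-- The (skew) standard Young tableaux of shape `λ/μ` and size `n`, encoded as chains.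
open scoped Classical in
noncomputable def skewSYT (mu lam : YoungDiagram) (n : ℕ) :
    Finset (Fin (n + 1) → YoungDiagram) :=
  (Fintype.piFinset fun _ : Fin (n + 1) => subDiagrams lam).filter
    fun c => c 0 = mu ∧ c (Fin.last n) = lam ∧ IsSYTChain c

-- `T_n` : all standard Young tableaux of size `n` (encoded as chains starting at `⊥`).
open scoped Classical in
noncomputable def allSYT (n : ℕ) : Finset (Fin (n + 1) → YoungDiagram) :=
  (Fintype.piFinset fun _ : Fin (n + 1) => subDiagrams (square n)).filter
    fun c => c 0 = ⊥ ∧ IsSYTChain c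

/-- The row in which the `(i+1)`-st cell of the chain `c` is added. -/
def rowOfStep {n : ℕ} (c : Fin (n + 1) → YoungDiagram) (i : ℕ) : ℕ :=
  if h : i < n then
    ((c ⟨i + 1, by omega⟩).cells \ (c ⟨i, by omega⟩).cells).sup Prod.fst
  else 0

/-- The major index of a (skew) standard Young tableau, encoded as a chain:
the sum of all `i` such that `i+1` lies in a lower row than `i`. -/
def chainMaj {n : ℕ} (c : Fin (n + 1) → YoungDiagram) : ℕ :=
  ∑ i ∈ Finset.range n,
    if i + 1 < n ∧ rowOfStep c i < rowOfStep c (i + 1) then i + 1 else 0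

/-- `f^{λ/μ}(q) = Σ_{sh(T) = λ/μ} q^{maj T}`, where `n` is the number of cells of `λ/μ`. -/
noncomputable def fSkew (mu lam : YoungDiagram) (n : ℕ) (q : ℝ) : ℝ :=
  ∑ c ∈ skewSYT mu lam n, q ^ chainMaj c

/-- `T_{>m}` : the skew tableau obtained from `T` by removing the entries `≤ m`. -/
def tailChain {n : ℕ} (c : Fin (n + 1) → YoungDiagram) (m : ℕ) :
    Fin (n - m + 1) → YoungDiagram :=
  fun i => c ⟨min (m + (i : ℕ)) n, by omega⟩

/-- `T` contains `A`, i.e. `T_{≤a} = A`. -/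
def containsT {n a : ℕ} (T : Fin (n + 1) → YoungDiagram)
    (A : Fin (a + 1) → YoungDiagram) : Prop :=
  ∀ i : Fin (a + 1), T ⟨min (i : ℕ) n, by omega⟩ = A i

-- `T_n(A,B)` : pairs of standard Young tableaux of the same shape, of size `n`,
-- containing `A` and `B` respectively.
open scoped Classical in
noncomputable def pairSYT (n : ℕ) {a b : ℕ} (A : Fin (a + 1) → YoungDiagram)
    (B : Fin (b + 1) → YoungDiagram) :
    Finset ((Fin (n + 1) → YoungDiagram) × (Fin (n + 1) → YoungDiagram)) :=
  ((allSYT n) ×ˢ (allSYT n)).filter fun PQ =>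
    PQ.1 (Fin.last n) = PQ.2 (Fin.last n) ∧ containsT PQ.1 A ∧ containsT PQ.2 B

/-- The empty standard Young tableau. -/
def emptySYT : Fin (0 + 1) → YoungDiagram := fun _ => ⊥

/-- Schensted row insertion: insert `x` into the row `r`, returning the new row and
the bumped entry (if any). -/
def insertRow : List ℕ → ℕ → List ℕ × Option ℕ
  | [], x => ([x], none)
  | y :: ys, x =>
    if x < y then (x :: ys, some y)
    else
      let p := insertRow ys x
      (y :: p.1, p.2)

/-- Schensted insertion of `x` into a tableau given as a list of rows. -/
def insertTab : List (List ℕ) → ℕ → List (List ℕ)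
  | [], x => [[x]]
  | r :: rs, x =>
    match insertRow r x with
    | (r', none) => r' :: rs
    | (r', some y) => r' :: insertTab rs y

/-- The Robinson–Schensted insertion tableau of a word. -/
def Ptab (w : List ℕ) : List (List ℕ) := w.foldl insertTab []

/-- The Young diagram with row lengths `r` (junk-robust version). -/
def diagramOfRows (r : List ℕ) : YoungDiagram :=
  ⟨(Finset.range r.length ×ˢ Finset.range (r.foldr max 0)).filter
      (fun p => ∀ i ≤ p.1, p.2 < r.getD i 0), by
    intro a b hab ha
    rw [Finset.mem_coe, Finset.mem_filter, Finset.mem_product] at ha ⊢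
    obtain ⟨⟨h1, h2⟩, h3⟩ := ha
    simp only [Finset.mem_range] at h1 h2 ⊢
    refine ⟨⟨lt_of_le_of_lt hab.1 h1, lt_of_le_of_lt hab.2 h2⟩, fun i hi => ?_⟩
    exact lt_of_le_of_lt hab.2 (h3 i (le_trans hi hab.1))⟩

/-- The shape of the Robinson–Schensted insertion tableau of a word. -/
def RSshape (w : List ℕ) : YoungDiagram := diagramOfRows ((Ptab w).map List.length)

/-- The one-line word of a permutation of `Fin a` (with values `0,…,a-1`). -/
def wordOf {a : ℕ} (σ : Equiv.Perm (Fin a)) : List ℕ :=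
  (List.finRange a).map fun i => (σ i : ℕ)

/-- The chain encoding of the Robinson–Schensted insertion tableau `P(σ)`:
its `i`-th diagram is the shape of the subtableau of `P(σ)` with entries `≤ i`,
which equals the RS-shape of the subword of `σ` with values `≤ i`. -/
def Pchain {a : ℕ} (σ : Equiv.Perm (Fin a)) : Fin (a + 1) → YoungDiagram :=
  fun i => RSshape ((wordOf σ).filter fun x => x < (i : ℕ))

/-- The chain encoding of the Robinson–Schensted recording tableau `Q(σ)`:
its `i`-th diagram is the shape of the subtableau of `Q(σ)` with entries `≤ i`,
which equals the RS-shape of the prefix of `σ` of length `i`. -/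
def Qchain {a : ℕ} (σ : Equiv.Perm (Fin a)) : Fin (a + 1) → YoungDiagram :=
  fun i => RSshape ((wordOf σ).take (i : ℕ))



theorem mem_subDiagrams {mu lam : YoungDiagram} : mu ∈ subDiagrams lam ↔ mu ≤ lam := by
  classical
  unfold subDiagrams
  rw [← YoungDiagram.cells_subset_iff]
  simp only [Finset.mem_image, Finset.mem_attach, true_and, Subtype.exists, Finset.mem_filter,
    Finset.mem_powerset]
  constructor
  · rintro ⟨s, ⟨hs, _⟩, rfl⟩
    exact hs
  · intro h
    exact ⟨mu.cells, ⟨h, mu.isLowerSet⟩, rfl⟩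

theorem lt_card_of_mem {mu : YoungDiagram} {i j : ℕ} (h : (i, j) ∈ mu) :
    i < mu.card ∧ j < mu.card := by
  have hsub : Finset.range (i + 1) ×ˢ Finset.range (j + 1) ⊆ mu.cells := by
    rintro ⟨x, y⟩ hxy
    simp only [Finset.mem_product, Finset.mem_range] at hxy
    exact mu.up_left_mem (by omega) (by omega) h
  have hc := Finset.card_le_card hsub
  rw [Finset.card_product, Finset.card_range, Finset.card_range] at hc
  change _ ≤ mu.card at hc
  constructor <;> nlinarith

theorem le_square {mu : YoungDiagram} {n : ℕ} (h : mu.card ≤ n) : mu ≤ square n := by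
  rw [← YoungDiagram.cells_subset_iff]
  rintro ⟨i, j⟩ hij
  have := lt_card_of_mem hij
  simp only [square, Finset.mem_product, Finset.mem_range]
  omega

theorem mem_diagramsOfCard {mu : YoungDiagram} {n : ℕ} :
    mu ∈ diagramsOfCard n ↔ mu.card = n := by
  rw [diagramsOfCard, Finset.mem_filter, mem_subDiagrams]
  exact ⟨fun h => h.2, fun h => ⟨le_square h.le, h⟩⟩

theorem card_le_card_of_le {mu nu : YoungDiagram} (h : mu ≤ nu) : mu.card ≤ nu.card :=
  Finset.card_le_card (YoungDiagram.cells_subset_iff.2 h)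

theorem eq_of_le_of_card_le {mu nu : YoungDiagram} (h : mu ≤ nu) (hc : nu.card ≤ mu.card) :
    mu = nu :=
  YoungDiagram.ext (Finset.eq_of_subset_of_card_le (YoungDiagram.cells_subset_iff.2 h) hc)

theorem card_sup_add_card_inf (mu nu : YoungDiagram) :
    (mu ⊔ nu).card + (mu ⊓ nu).card = mu.card + nu.card := by
  simp only [YoungDiagram.card, YoungDiagram.cells_sup, YoungDiagram.cells_inf]
  exact Finset.card_union_add_card_inter _ _

theorem card_bot : (⊥ : YoungDiagram).card = 0 := by
  simp [YoungDiagram.card]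

theorem eq_bot_of_card_eq_zero {mu : YoungDiagram} (h : mu.card = 0) : mu = ⊥ :=
  (eq_of_le_of_card_le bot_le (by rw [h]; exact Nat.zero_le _)).symm

/-- The Young diagrams obtained from `mu` by removing one cell. -/
noncomputable def lowerCovers (mu : YoungDiagram) : Finset YoungDiagram :=
  (subDiagrams mu).filter fun nu => nu.card + 1 = mu.card

open scoped Classical in
/-- The Young diagrams obtained from `mu` by adding one cell. -/
noncomputable def upperCovers (mu : YoungDiagram) : Finset YoungDiagram :=
  (diagramsOfCard (mu.card + 1)).filter fun nu => mu ≤ nu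

theorem mem_lowerCovers {mu nu : YoungDiagram} :
    nu ∈ lowerCovers mu ↔ nu ≤ mu ∧ nu.card + 1 = mu.card := by
  rw [lowerCovers, Finset.mem_filter, mem_subDiagrams]

theorem mem_upperCovers {mu nu : YoungDiagram} :
    nu ∈ upperCovers mu ↔ mu ≤ nu ∧ nu.card = mu.card + 1 := by
  classical
  rw [upperCovers, Finset.mem_filter, mem_diagramsOfCard, and_comm]

theorem mem_upperCovers_iff_mem_lowerCovers {mu nu : YoungDiagram} :
    nu ∈ upperCovers mu ↔ mu ∈ lowerCovers nu := by
  rw [mem_upperCovers, mem_lowerCovers, eq_comm (a := mu.card + 1)]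

/-- The rows of `mu` whose last cell can be removed. -/
def cornerRows (mu : YoungDiagram) : Finset ℕ :=
  (Finset.range mu.card).filter fun i => mu.rowLen (i + 1) < mu.rowLen i

theorem mem_cornerRows {mu : YoungDiagram} {i : ℕ} :
    i ∈ cornerRows mu ↔ mu.rowLen (i + 1) < mu.rowLen i := by
  rw [cornerRows, Finset.mem_filter, Finset.mem_range, and_iff_right_iff_imp]
  intro h
  exact (lt_card_of_mem (YoungDiagram.mem_iff_lt_rowLen.2 (Nat.zero_lt_of_lt h))).1

/-- Remove the last cell of a corner row. -/
def removeCell (mu : YoungDiagram) (i : ℕ) (hi : mu.rowLen (i + 1) < mu.rowLen i) :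
    YoungDiagram where
  cells := mu.cells.erase (i, mu.rowLen i - 1)
  isLowerSet := by
    rintro ⟨x, y⟩ ⟨x', y'⟩ ⟨hx, hy⟩ hmem
    simp only [Finset.coe_erase, Set.mem_sdiff, Finset.mem_coe, Set.mem_singleton_iff,
      YoungDiagram.mem_cells, Prod.mk.injEq] at hmem hx hy ⊢
    refine ⟨mu.up_left_mem hx hy hmem.1, ?_⟩
    rintro ⟨rfl, rfl⟩
    have h1 := YoungDiagram.mem_iff_lt_rowLen.1 hmem.1
    rcases Nat.eq_or_lt_of_le hx with rfl | hlt
    · omega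
    · have := mu.rowLen_anti (x' + 1) x hlt
      omega

/-- Add a cell at the end of row `i`. -/
def addCell (mu : YoungDiagram) (i : ℕ) (hi : ∀ j, i = j + 1 → mu.rowLen i < mu.rowLen j) :
    YoungDiagram where
  cells := insert (i, mu.rowLen i) mu.cells
  isLowerSet := by
    rintro ⟨x, y⟩ ⟨x', y'⟩ ⟨hx, hy⟩ hmem
    simp only [Finset.coe_insert, Set.mem_insert_iff, Finset.mem_coe,
      YoungDiagram.mem_cells, Prod.mk.injEq] at hmem hx hy ⊢
    rcases hmem with ⟨rfl, rfl⟩ | hmem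
    · rcases Nat.eq_or_lt_of_le hx with rfl | hlt
      · rcases Nat.eq_or_lt_of_le hy with rfl | hlt
        · exact Or.inl ⟨rfl, rfl⟩
        · exact Or.inr (YoungDiagram.mem_iff_lt_rowLen.2 hlt)
      · right
        obtain ⟨j, rfl⟩ : ∃ j, x = j + 1 := ⟨x - 1, by omega⟩
        have h1 := hi j rfl
        have h2 := mu.rowLen_anti x' j (by omega)
        exact YoungDiagram.mem_iff_lt_rowLen.2 (by omega)
    · exact Or.inr (mu.up_left_mem hx hy hmem)

theorem exists_insert_of_le {mu nu : YoungDiagram} (h : mu ≤ nu) (hc : mu.card + 1 = nu.card) :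
    ∃ i j, (i, j) ∉ mu ∧ nu.cells = insert (i, j) mu.cells := by
  obtain ⟨⟨i, j⟩, h1, h2⟩ :=
    Finset.exists_eq_insert_iff.2 ⟨YoungDiagram.cells_subset_iff.2 h, hc⟩
  exact ⟨i, j, h1, h2.symm⟩

theorem card_lowerCovers (mu : YoungDiagram) : (lowerCovers mu).card = (cornerRows mu).card := by
  symm
  refine Finset.card_bij (fun i hi => removeCell mu i (mem_cornerRows.1 hi)) ?_ ?_ ?_
  · intro i hi
    have hi' := mem_cornerRows.1 hi
    have hm : (i, mu.rowLen i - 1) ∈ mu.cells :=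
      YoungDiagram.mem_iff_lt_rowLen.2 (by omega)
    rw [mem_lowerCovers]
    exact ⟨YoungDiagram.cells_subset_iff.1 (Finset.erase_subset _ _),
      Finset.card_erase_add_one hm⟩
  · intro i hi j hj hij
    have hi' := mem_cornerRows.1 hi
    have hm : (i, mu.rowLen i - 1) ∈ mu.cells :=
      YoungDiagram.mem_iff_lt_rowLen.2 (by omega)
    have hcells := congrArg YoungDiagram.cells hij
    simp only [removeCell] at hcells
    exact congrArg Prod.fst ((Finset.erase_inj _ hm).1 hcells)
  · intro nu hnu
    rw [mem_lowerCovers] at hnu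
    obtain ⟨i, j, hij, hcells⟩ := exists_insert_of_le hnu.1 hnu.2
    have key : ∀ c, c ∈ mu ↔ c = (i, j) ∨ c ∈ nu := fun c => by
      rw [← YoungDiagram.mem_cells, hcells, Finset.mem_insert, YoungDiagram.mem_cells]
    have h1 : (i, j) ∈ mu := (key _).2 (Or.inl rfl)
    have h2 : (i, j + 1) ∉ mu := fun h => by
      rcases (key _).1 h with h | h
      · simp at h
      · exact hij (nu.up_left_mem le_rfl (Nat.le_succ j) h)
    have h3 : (i + 1, j) ∉ mu := fun h => by
      rcases (key _).1 h with h | h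
      · simp at h
      · exact hij (nu.up_left_mem (Nat.le_succ i) le_rfl h)
    rw [YoungDiagram.mem_iff_lt_rowLen] at h1 h2 h3
    refine ⟨i, mem_cornerRows.2 (by omega), YoungDiagram.ext ?_⟩
    have hj : mu.rowLen i - 1 = j := by omega
    simp only [removeCell, hj, hcells]
    exact Finset.erase_insert hij

theorem card_upperCovers (mu : YoungDiagram) :
    (upperCovers mu).card = (cornerRows mu).card + 1 := by
  have hcard : (insert 0 ((cornerRows mu).image Nat.succ)).card = (cornerRows mu).card + 1 := by
    rw [Finset.card_insert_of_notMem (by simp),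
      Finset.card_image_of_injective _ Nat.succ_injective]
  have hmem : ∀ i, i ∈ insert 0 ((cornerRows mu).image Nat.succ) ↔
      ∀ j, i = j + 1 → mu.rowLen i < mu.rowLen j := by
    intro i
    rcases i with _ | i
    · simp
    · simp [mem_cornerRows]
  rw [← hcard]
  symm
  refine Finset.card_bij (fun i hi => addCell mu i ((hmem i).1 hi)) ?_ ?_ ?_
  · intro i hi
    have hm : (i, mu.rowLen i) ∉ mu.cells := fun h =>
      lt_irrefl _ (YoungDiagram.mem_iff_lt_rowLen.1 h)
    rw [mem_upperCovers]
    exact ⟨YoungDiagram.cells_subset_iff.1 (Finset.subset_insert _ _),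
      Finset.card_insert_of_notMem hm⟩
  · intro i hi j hj hij
    have hm : (i, mu.rowLen i) ∉ mu.cells := fun h =>
      lt_irrefl _ (YoungDiagram.mem_iff_lt_rowLen.1 h)
    have hcells := congrArg YoungDiagram.cells hij
    simp only [addCell] at hcells
    exact congrArg Prod.fst ((Finset.insert_inj hm).1 hcells)
  · intro nu hnu
    rw [mem_upperCovers] at hnu
    obtain ⟨i, j, hij, hcells⟩ := exists_insert_of_le hnu.1 hnu.2.symm
    have key : ∀ c, c ∈ nu ↔ c = (i, j) ∨ c ∈ mu := fun c => by
      rw [← YoungDiagram.mem_cells, hcells, Finset.mem_insert, YoungDiagram.mem_cells]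
    have h1 : (i, j) ∈ nu := (key _).2 (Or.inl rfl)
    have hj : mu.rowLen i = j := by
      rw [YoungDiagram.mem_iff_lt_rowLen] at hij
      by_contra hne
      rcases (key _).1 (nu.up_left_mem le_rfl (show mu.rowLen i ≤ j by omega) h1) with h | h
      · simp only [Prod.mk.injEq, true_and] at h
        exact hne h
      · exact lt_irrefl _ (YoungDiagram.mem_iff_lt_rowLen.1 h)
    refine ⟨i, (hmem i).2 ?_, YoungDiagram.ext ?_⟩
    · rintro i' rfl
      rw [hj]
      rcases (key _).1 (nu.up_left_mem (Nat.le_succ i') le_rfl h1) with h | h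
      · simp at h
      · exact YoungDiagram.mem_iff_lt_rowLen.1 h
    · simp only [addCell, hj, hcells]

/-- The commutation relation `D U = U D + 1` of Young's lattice. -/
theorem sum_upperCovers_sum_lowerCovers (h : YoungDiagram → ℕ) (mu : YoungDiagram) :
    ∑ lam ∈ upperCovers mu, ∑ nu ∈ lowerCovers lam, h nu =
      h mu + ∑ kap ∈ lowerCovers mu, ∑ nu ∈ upperCovers kap, h nu := by
  classical
  have h1 : ∀ lam ∈ upperCovers mu, ∑ nu ∈ lowerCovers lam, h nu =
      h mu + ∑ nu ∈ (lowerCovers lam).erase mu, h nu := fun lam hl =>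
    (Finset.add_sum_erase _ _ (mem_upperCovers_iff_mem_lowerCovers.1 hl)).symm
  have h2 : ∀ kap ∈ lowerCovers mu, ∑ nu ∈ upperCovers kap, h nu =
      h mu + ∑ nu ∈ (upperCovers kap).erase mu, h nu := fun kap hk =>
    (Finset.add_sum_erase _ _ (mem_upperCovers_iff_mem_lowerCovers.2 hk)).symm
  rw [Finset.sum_congr rfl h1, Finset.sum_congr rfl h2, Finset.sum_add_distrib,
    Finset.sum_add_distrib, Finset.sum_const, Finset.sum_const, card_upperCovers,
    card_lowerCovers, smul_eq_mul, smul_eq_mul]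
  have hswap : ∑ lam ∈ upperCovers mu, ∑ nu ∈ (lowerCovers lam).erase mu, h nu =
      ∑ kap ∈ lowerCovers mu, ∑ nu ∈ (upperCovers kap).erase mu, h nu := by
    rw [Finset.sum_sigma', Finset.sum_sigma']
    have hdown : ∀ lam nu : YoungDiagram, mu ≤ lam → lam.card = mu.card + 1 → nu ≠ mu →
        nu ≤ lam → nu.card + 1 = lam.card → mu ⊔ nu = lam ∧ (mu ⊓ nu).card + 1 = mu.card := by
      intro lam nu a1 a2 a3 a4 a5
      have hlt : mu.card < (mu ⊔ nu).card := by
        by_contra hle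
        have e1 := eq_of_le_of_card_le (le_sup_left : mu ≤ mu ⊔ nu) (by omega)
        have e2 : nu ≤ mu := by rw [e1]; exact le_sup_right
        exact a3 (eq_of_le_of_card_le e2 (by omega))
      have hs := card_sup_add_card_inf mu nu
      have e := eq_of_le_of_card_le (sup_le a1 a4) (by omega)
      exact ⟨e, by rw [e] at hs; omega⟩
    have hup : ∀ kap nu : YoungDiagram, kap ≤ mu → kap.card + 1 = mu.card → nu ≠ mu →
        kap ≤ nu → nu.card = kap.card + 1 → mu ⊓ nu = kap ∧ (mu ⊔ nu).card = mu.card + 1 := by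
      intro kap nu a1 a2 a3 a4 a5
      have hlt : (mu ⊓ nu).card < mu.card := by
        by_contra hle
        have e1 := eq_of_le_of_card_le (inf_le_left : mu ⊓ nu ≤ mu) (by omega)
        have e2 : mu ≤ nu := by rw [← e1]; exact inf_le_right
        exact a3 (eq_of_le_of_card_le e2 (by omega)).symm
      have hs := card_sup_add_card_inf mu nu
      have e := (eq_of_le_of_card_le (le_inf a1 a4) (by omega)).symm
      exact ⟨e, by rw [e] at hs; omega⟩
    refine Finset.sum_bij' (fun x _ => ⟨mu ⊓ x.2, x.2⟩) (fun x _ => ⟨mu ⊔ x.2, x.2⟩)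
      ?_ ?_ ?_ ?_ ?_
    · rintro ⟨lam, nu⟩ hx
      simp only [Finset.mem_sigma, mem_upperCovers, Finset.mem_erase, mem_lowerCovers] at hx ⊢
      obtain ⟨⟨a1, a2⟩, a3, a4, a5⟩ := hx
      obtain ⟨b1, b2⟩ := hdown lam nu a1 a2 a3 a4 a5
      exact ⟨⟨inf_le_left, b2⟩, a3, inf_le_right, by omega⟩
    · rintro ⟨kap, nu⟩ hx
      simp only [Finset.mem_sigma, mem_upperCovers, Finset.mem_erase, mem_lowerCovers] at hx ⊢
      obtain ⟨⟨a1, a2⟩, a3, a4, a5⟩ := hx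
      obtain ⟨b1, b2⟩ := hup kap nu a1 a2 a3 a4 a5
      exact ⟨⟨le_sup_left, b2⟩, a3, le_sup_right, by omega⟩
    · rintro ⟨lam, nu⟩ hx
      simp only [Finset.mem_sigma, mem_upperCovers, Finset.mem_erase, mem_lowerCovers] at hx ⊢
      obtain ⟨⟨a1, a2⟩, a3, a4, a5⟩ := hx
      rw [(hdown lam nu a1 a2 a3 a4 a5).1]
    · rintro ⟨kap, nu⟩ hx
      simp only [Finset.mem_sigma, mem_upperCovers, Finset.mem_erase, mem_lowerCovers] at hx ⊢
      obtain ⟨⟨a1, a2⟩, a3, a4, a5⟩ := hx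
      rw [(hup kap nu a1 a2 a3 a4 a5).1]
    · intro x _
      rfl
  rw [hswap]
  ring

open scoped Classical in
/-- The number of saturated chains of length `k` from `mu` to `lam` in Young's lattice. -/
noncomputable def numChains (mu : YoungDiagram) : ℕ → YoungDiagram → ℕ
  | 0, lam => if lam = mu then 1 else 0
  | k + 1, lam => ∑ nu ∈ lowerCovers lam, numChains mu k nu

theorem numChains_eq_zero {mu lam : YoungDiagram} {k : ℕ} (h : lam.card ≠ mu.card + k) :
    numChains mu k lam = 0 := by
  induction k generalizing lam with
  | zero =>
    rw [numChains, if_neg]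
    rintro rfl
    exact h rfl
  | succ k ih =>
    rw [numChains]
    refine Finset.sum_eq_zero fun nu hnu => ih ?_
    have := (mem_lowerCovers.1 hnu).2
    omega

theorem sum_upperCovers_numChains (mu nu : YoungDiagram) (k : ℕ) :
    ∑ lam ∈ upperCovers nu, numChains mu k lam =
      k * numChains mu (k - 1) nu + ∑ kap ∈ lowerCovers mu, numChains kap k nu := by
  classical
  induction k generalizing nu with
  | zero =>
    simp only [numChains, Finset.sum_ite_eq', Finset.sum_ite_eq, zero_mul, zero_add,
      mem_upperCovers_iff_mem_lowerCovers]
  | succ k ih =>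
    simp only [numChains]
    rw [sum_upperCovers_sum_lowerCovers, Finset.sum_congr rfl fun kap _ => ih kap,
      Finset.sum_add_distrib, Finset.sum_comm, ← Finset.mul_sum, Nat.add_sub_cancel]
    rcases k with _ | k
    · simp
    · simp only [Nat.add_sub_cancel, numChains]
      ring

/-- The number of pairs of saturated chains from `mu` and from `nu` to a common diagram with
`n` cells. -/
noncomputable def numChainPairs (nu : YoungDiagram) (n : ℕ) (mu : YoungDiagram) : ℕ :=
  ∑ lam ∈ diagramsOfCard n, numChains mu (n - mu.card) lam * numChains nu (n - nu.card) lam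

theorem numChainPairs_succ {mu nu : YoungDiagram} {n : ℕ} (hmu : mu.card ≤ n)
    (hnu : nu.card ≤ n) :
    numChainPairs nu (n + 1) mu =
      (n + 1 - mu.card) * numChainPairs nu n mu +
        ∑ kap ∈ lowerCovers mu, numChainPairs nu n kap := by
  have hswap : numChainPairs nu (n + 1) mu =
      ∑ rho ∈ diagramsOfCard n, ∑ lam ∈ upperCovers rho,
        numChains mu (n + 1 - mu.card) lam * numChains nu (n - nu.card) rho := by
    rw [numChainPairs, Nat.succ_sub hnu]
    simp only [numChains, Finset.mul_sum]
    refine Finset.sum_comm' fun lam rho => ?_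
    rw [mem_upperCovers_iff_mem_lowerCovers, mem_lowerCovers, mem_diagramsOfCard,
      mem_diagramsOfCard]
    constructor <;> rintro ⟨h1, h2⟩ <;> simp_all
  rw [hswap]
  simp only [← Finset.sum_mul, sum_upperCovers_numChains, add_mul, Finset.sum_add_distrib]
  congr 1
  · rw [numChainPairs, Finset.mul_sum]
    refine Finset.sum_congr rfl fun rho _ => ?_
    rw [show n + 1 - mu.card - 1 = n - mu.card by omega]
    ring
  · simp only [Finset.sum_mul, numChainPairs]
    rw [Finset.sum_comm]
    refine Finset.sum_congr rfl fun kap hkap => ?_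
    have := (mem_lowerCovers.1 hkap).2
    rw [show n + 1 - mu.card = n - kap.card by omega]

theorem lowerCovers_bot : lowerCovers ⊥ = ∅ := by
  refine Finset.eq_empty_of_forall_notMem fun nu hnu => ?_
  have := (mem_lowerCovers.1 hnu).2
  rw [card_bot] at this
  omega

theorem numChainPairs_self (nu : YoungDiagram) :
    numChainPairs nu nu.card ⊥ = numChains ⊥ nu.card nu := by
  classical
  rw [numChainPairs, Finset.sum_eq_single nu]
  · simp [numChains, card_bot]
  · intro lam _ hne
    simp [numChains, hne]
  · intro h
    exact absurd (mem_diagramsOfCard.2 rfl) h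

theorem numChainPairs_bot_mul_factorial {nu : YoungDiagram} {n : ℕ} (h : nu.card ≤ n) :
    numChainPairs nu n ⊥ * nu.card.factorial = numChains ⊥ nu.card nu * n.factorial := by
  induction n, h using Nat.le_induction with
  | base => rw [numChainPairs_self]
  | succ n hn ih =>
    rw [numChainPairs_succ (by rw [card_bot]; exact Nat.zero_le _) hn, lowerCovers_bot, card_bot,
      Finset.sum_empty, Nat.factorial_succ, Nat.sub_zero, add_zero, mul_assoc, ih]
    ring

open Filter Topology Asymptotics

/-- A sequence whose differences are asymptotic to `L * n.choose a` is asymptotic to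
`L * n.choose (a + 1)`. -/
theorem tendsto_div_choose_succ {g : ℕ → ℝ} {a : ℕ} {L : ℝ}
    (h : Tendsto (fun n => (g (n + 1) - g n) / (n.choose a : ℝ)) atTop (𝓝 L)) :
    Tendsto (fun n => g n / (n.choose (a + 1) : ℝ)) atTop (𝓝 L) := by
  have hsum : ∀ n : ℕ, ∑ i ∈ range n, (i.choose a : ℝ) = (n.choose (a + 1) : ℝ) := by
    intro n
    induction n with
    | zero => simp
    | succ n ih => rw [Finset.sum_range_succ, ih, Nat.choose_succ_succ]; push_cast; ring
  have hpos : ∀ k : ℕ, ∀ᶠ n : ℕ in atTop, ((n.choose k : ℕ) : ℝ) ≠ 0 := fun k => by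
    filter_upwards [eventually_ge_atTop k] with n hn
    exact_mod_cast (Nat.choose_pos hn).ne'
  have htop : Tendsto (fun n : ℕ => (n.choose (a + 1) : ℝ)) atTop atTop := by
    refine tendsto_natCast_atTop_atTop.comp ?_
    refine tendsto_atTop_mono' atTop ?_ (tendsto_sub_atTop_nat a)
    filter_upwards [eventually_ge_atTop (a + 1)] with n hn
    obtain ⟨m, rfl⟩ := Nat.exists_eq_add_of_le hn
    have : ∀ m : ℕ, m + 1 ≤ (a + 1 + m).choose (a + 1) := by
      intro m
      induction m with
      | zero => simp
      | succ m ih =>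
        rw [← add_assoc, Nat.choose_succ_succ, Nat.succ_eq_add_one]
        have : 0 < (a + 1 + m).choose a := Nat.choose_pos (by omega)
        omega
    have := this m
    omega
  have hlo : (fun n => g (n + 1) - g n - L * (n.choose a : ℝ)) =o[atTop]
      fun n => (n.choose a : ℝ) := by
    rw [isLittleO_iff_tendsto' ((hpos a).mono fun n hn h0 => absurd h0 hn)]
    have h' := h.sub_const L
    rw [sub_self] at h'
    refine h'.congr' ?_
    filter_upwards [hpos a] with n hn
    field_simp
  have hlo' := hlo.sum_range (fun n => Nat.cast_nonneg _) (by simpa only [hsum] using htop)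
  simp only [Finset.sum_sub_distrib _ (fun i : ℕ => L * (i.choose a : ℝ)), Finset.sum_range_sub,
    ← Finset.mul_sum, hsum] at hlo'
  have h1 := hlo'.tendsto_div_nhds_zero
  have h2 : Tendsto (fun n : ℕ => g 0 / (n.choose (a + 1) : ℝ)) atTop (𝓝 0) :=
    tendsto_const_nhds.div_atTop htop
  have h3 := (h1.add h2).add_const L
  rw [add_zero, zero_add] at h3
  refine h3.congr' ?_
  filter_upwards [hpos (a + 1)] with n hn
  field_simp
  ring

theorem tendsto_numChainPairs_div (nu : YoungDiagram) (a : ℕ) (mu : YoungDiagram)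
    (hmu : mu.card = a) :
    Tendsto (fun n : ℕ => (numChainPairs nu n mu : ℝ) / (n - a).factorial / (n.choose a : ℝ))
      atTop (𝓝 ((numChains ⊥ a mu : ℝ) * numChains ⊥ nu.card nu / nu.card.factorial)) := by
  induction a generalizing mu with
  | zero =>
    obtain rfl := eq_bot_of_card_eq_zero hmu
    refine tendsto_const_nhds.congr' ?_
    filter_upwards [eventually_ge_atTop nu.card] with n hn
    have h := numChainPairs_bot_mul_factorial hn
    have h' : (numChainPairs nu n ⊥ : ℝ) * nu.card.factorial =
      numChains ⊥ nu.card nu * n.factorial := by exact_mod_cast h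
    have := Nat.factorial_ne_zero n
    have := Nat.factorial_ne_zero nu.card
    simp only [numChains, if_true, Nat.cast_one, one_mul, Nat.sub_zero, Nat.choose_zero_right,
      div_one]
    rw [div_eq_div_iff (by positivity) (by positivity), h']
  | succ a ih =>
    have hcard : ∀ kap ∈ lowerCovers mu, kap.card = a := fun kap hk => by
      have := (mem_lowerCovers.1 hk).2
      omega
    refine tendsto_div_choose_succ ?_
    have hs := tendsto_finsetSum (lowerCovers mu) fun kap hk => ih kap (hcard kap hk)
    simp only [numChains, Nat.cast_sum]
    simp only [← Finset.sum_div, ← Finset.sum_mul] at hs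
    refine hs.congr' ?_
    filter_upwards [eventually_ge_atTop (a + 1), eventually_ge_atTop nu.card] with n hn hn'
    rw [numChainPairs_succ (by omega) hn', hmu]
    obtain ⟨m, rfl⟩ := Nat.exists_eq_add_of_le hn
    rw [show a + 1 + m - a = m + 1 by omega, show a + 1 + m + 1 - (a + 1) = m + 1 by omega,
      show a + 1 + m - (a + 1) = m by omega, Nat.factorial_succ]
    have := Nat.factorial_ne_zero m
    congr 1
    push_cast
    field_simp
    ring

theorem tendsto_numChainPairs (mu nu : YoungDiagram) :
    Tendsto (fun n : ℕ => (numChainPairs nu n mu : ℝ) / n.factorial) atTop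
      (𝓝 ((numChains ⊥ mu.card mu : ℝ) * numChains ⊥ nu.card nu /
        (mu.card.factorial * nu.card.factorial))) := by
  have h := (tendsto_numChainPairs_div nu mu.card mu rfl).div_const (mu.card.factorial : ℝ)
  rw [div_div, mul_comm (nu.card.factorial : ℝ)] at h
  refine h.congr' ?_
  filter_upwards [eventually_ge_atTop mu.card] with n hn
  have h1 := Nat.choose_mul_factorial_mul_factorial hn
  rw [← h1, div_div, div_div]
  push_cast
  congr 1
  ring

theorem isSYTChain_succ_iff {n : ℕ} {c : Fin (n + 1 + 1) → YoungDiagram} :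
    IsSYTChain c ↔ IsSYTChain (Fin.init c) ∧
      Fin.init c (Fin.last n) ∈ lowerCovers (c (Fin.last (n + 1))) := by
  rw [mem_lowerCovers]
  constructor
  · intro h
    exact ⟨fun i hi => h i (by omega), (h n (by omega)).1, (h n (by omega)).2.symm⟩
  · rintro ⟨h1, h2, h3⟩ i hi
    rcases Nat.lt_succ_iff_lt_or_eq.1 hi with hlt | rfl
    · exact h1 i hlt
    · exact ⟨h2, h3.symm⟩

theorem IsSYTChain.card_eq {n : ℕ} {c : Fin (n + 1) → YoungDiagram} (h : IsSYTChain c)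
    (h0 : c 0 = ⊥) (i : Fin (n + 1)) : (c i).card = i := by
  obtain ⟨i, hi⟩ := i
  induction i with
  | zero => exact (congrArg YoungDiagram.card h0).trans card_bot
  | succ i ih => exact (h i (by omega)).2.trans (by rw [ih])

theorem IsSYTChain.le_last {n : ℕ} {c : Fin (n + 1) → YoungDiagram} (h : IsSYTChain c)
    (i : Fin (n + 1)) : c i ≤ c (Fin.last n) := by
  induction n with
  | zero => rw [show i = Fin.last 0 from Fin.ext (by omega)]
  | succ n ih =>
    obtain ⟨h1, h2⟩ := isSYTChain_succ_iff.1 h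
    induction i using Fin.lastCases with
    | last => exact le_rfl
    | cast i => exact (ih h1 i).trans (mem_lowerCovers.1 h2).1

theorem mem_allSYT {n : ℕ} {c : Fin (n + 1) → YoungDiagram} :
    c ∈ allSYT n ↔ c 0 = ⊥ ∧ IsSYTChain c := by
  classical
  rw [allSYT, Finset.mem_filter, Fintype.mem_piFinset, and_iff_right_iff_imp]
  rintro ⟨h0, h⟩ i
  rw [mem_subDiagrams]
  exact le_square (by rw [h.card_eq h0]; omega)

theorem mem_skewSYT {mu lam : YoungDiagram} {n : ℕ} {c : Fin (n + 1) → YoungDiagram} :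
    c ∈ skewSYT mu lam n ↔ c 0 = mu ∧ c (Fin.last n) = lam ∧ IsSYTChain c := by
  classical
  rw [skewSYT, Finset.mem_filter, Fintype.mem_piFinset, and_iff_right_iff_imp]
  rintro ⟨_, rfl, h⟩ i
  rw [mem_subDiagrams]
  exact h.le_last i

theorem containsT_self_iff {a : ℕ} {T A : Fin (a + 1) → YoungDiagram} :
    containsT T A ↔ T = A := by
  rw [containsT, funext_iff]
  refine forall_congr' fun i => ?_
  have : (⟨min (i : ℕ) a, by omega⟩ : Fin (a + 1)) = i := Fin.ext (by simp; omega)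
  rw [this]

theorem containsT_succ_iff {a n : ℕ} (h : a ≤ n) {T : Fin (n + 1 + 1) → YoungDiagram}
    {A : Fin (a + 1) → YoungDiagram} : containsT T A ↔ containsT (Fin.init T) A := by
  refine forall_congr' fun i => ?_
  have : (⟨min (i : ℕ) (n + 1), by omega⟩ : Fin (n + 1 + 1)) =
      Fin.castSucc ⟨min (i : ℕ) n, by omega⟩ := Fin.ext (by simp; omega)
  rw [this]
  rfl

open scoped Classical in
/-- The standard Young tableaux of shape `lam` and size `n` containing `A`. -/
noncomputable def extensions (n : ℕ) {a : ℕ} (A : Fin (a + 1) → YoungDiagram)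
    (lam : YoungDiagram) : Finset (Fin (n + 1) → YoungDiagram) :=
  (allSYT n).filter fun T => T (Fin.last n) = lam ∧ containsT T A

theorem mem_extensions {n a : ℕ} {A : Fin (a + 1) → YoungDiagram} {lam : YoungDiagram}
    {T : Fin (n + 1) → YoungDiagram} :
    T ∈ extensions n A lam ↔ (T 0 = ⊥ ∧ IsSYTChain T) ∧ T (Fin.last n) = lam ∧ containsT T A := by
  classical
  rw [extensions, Finset.mem_filter, mem_allSYT]

theorem card_extensions {a n : ℕ} {A : Fin (a + 1) → YoungDiagram} (hA : A ∈ allSYT a)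
    (h : a ≤ n) (lam : YoungDiagram) :
    (extensions n A lam).card = numChains (A (Fin.last a)) (n - a) lam := by
  classical
  induction n, h using Nat.le_induction generalizing lam with
  | base =>
    rw [Nat.sub_self, numChains]
    split_ifs with hl
    · rw [Finset.card_eq_one]
      refine ⟨A, Finset.ext fun T => ?_⟩
      rw [mem_extensions, containsT_self_iff, Finset.mem_singleton]
      constructor
      · exact fun h => h.2.2
      · rintro rfl
        exact ⟨mem_allSYT.1 hA, hl.symm, rfl⟩
    · rw [Finset.card_eq_zero]
      refine Finset.eq_empty_of_forall_notMem fun T hT => ?_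
      rw [mem_extensions, containsT_self_iff] at hT
      obtain ⟨_, h1, rfl⟩ := hT
      exact hl h1.symm
  | succ n hn ih =>
    rw [Nat.succ_sub hn, numChains, ← Finset.sum_congr rfl fun nu _ => ih nu,
      ← Finset.card_sigma]
    refine Finset.card_bij' (fun T _ => ⟨Fin.init T (Fin.last n), Fin.init T⟩)
      (fun x _ => Fin.snoc (α := fun _ => YoungDiagram) x.2 lam) ?_ ?_ ?_ ?_
    · intro T hT
      rw [mem_extensions, isSYTChain_succ_iff, containsT_succ_iff hn] at hT
      obtain ⟨⟨h0, h1, h2⟩, rfl, h3⟩ := hT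
      exact Finset.mem_sigma.2 ⟨h2, mem_extensions.2 ⟨⟨h0, h1⟩, rfl, h3⟩⟩
    · rintro ⟨nu, T⟩ hT
      rw [Finset.mem_sigma, mem_extensions] at hT
      dsimp only at hT ⊢
      obtain ⟨h2, ⟨h0, h1⟩, h, h3⟩ := hT
      subst h
      rw [mem_extensions, isSYTChain_succ_iff, containsT_succ_iff hn, Fin.init_snoc, Fin.snoc_last]
      refine ⟨⟨?_, h1, h2⟩, rfl, h3⟩
      rw [← Fin.castSucc_zero, Fin.snoc_castSucc]
      exact h0
    · intro T hT
      rw [mem_extensions] at hT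
      obtain ⟨_, rfl, _⟩ := hT
      exact Fin.snoc_init_self T
    · rintro ⟨nu, T⟩ hT
      rw [Finset.mem_sigma, mem_extensions] at hT
      dsimp only at hT ⊢
      obtain ⟨_, _, h, _⟩ := hT
      subst h
      simp only [Fin.init_snoc]

theorem card_pairSYT {a b n : ℕ} {A : Fin (a + 1) → YoungDiagram}
    {B : Fin (b + 1) → YoungDiagram} (hA : A ∈ allSYT a) (hB : B ∈ allSYT b)
    (ha : a ≤ n) (hb : b ≤ n) :
    (pairSYT n A B).card = numChainPairs (B (Fin.last b)) n (A (Fin.last a)) := by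
  classical
  have hAc : (A (Fin.last a)).card = a := (mem_allSYT.1 hA).2.card_eq (mem_allSYT.1 hA).1 _
  have hBc : (B (Fin.last b)).card = b := (mem_allSYT.1 hB).2.card_eq (mem_allSYT.1 hB).1 _
  rw [numChainPairs, hAc, hBc, Finset.card_eq_sum_card_fiberwise
    (f := fun PQ => PQ.1 (Fin.last n)) (t := diagramsOfCard n)]
  · refine Finset.sum_congr rfl fun lam _ => ?_
    rw [← card_extensions hA ha, ← card_extensions hB hb, ← Finset.card_product]
    congr 1
    ext ⟨P, Q⟩
    simp only [pairSYT, extensions, Finset.mem_filter, Finset.mem_product]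
    constructor
    · rintro ⟨⟨⟨h1, h2⟩, h3, h4, h5⟩, rfl⟩
      exact ⟨⟨h1, rfl, h4⟩, h2, h3.symm, h5⟩
    · rintro ⟨⟨h1, rfl, h4⟩, h2, h3, h5⟩
      exact ⟨⟨⟨h1, h2⟩, h3.symm, h4, h5⟩, rfl⟩
  · rintro ⟨P, Q⟩ hPQ
    simp only [pairSYT, Finset.mem_coe, Finset.mem_filter, Finset.mem_product] at hPQ
    have hP := mem_allSYT.1 hPQ.1.1
    exact Finset.mem_coe.2 (mem_diagramsOfCard.2 (hP.2.card_eq hP.1 _))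

theorem emptySYT_mem_allSYT : emptySYT ∈ allSYT 0 :=
  mem_allSYT.2 ⟨rfl, fun i hi => absurd hi (Nat.not_lt_zero i)⟩

theorem card_skewSYT_bot (lam : YoungDiagram) (n : ℕ) :
    (skewSYT ⊥ lam n).card = numChains ⊥ n lam := by
  have h := card_extensions emptySYT_mem_allSYT (Nat.zero_le n) lam
  rw [Nat.sub_zero] at h
  rw [show (⊥ : YoungDiagram) = emptySYT (Fin.last 0) from rfl, ← h]
  congr 1
  ext T
  rw [mem_extensions, mem_skewSYT]
  constructor
  · rintro ⟨h1, h2, h3⟩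
    refine ⟨⟨h1, h3⟩, h2, fun i => ?_⟩
    obtain rfl : 0 = i := Fin.ext (by simp)
    exact (congrArg T (Fin.ext (by simp))).trans h1
  · rintro ⟨⟨h1, h3⟩, h2, _⟩
    exact ⟨h1, h2, h3⟩

theorem card_pairSYT_empty (n : ℕ) :
    (pairSYT n emptySYT emptySYT).card = n.factorial := by
  classical
  rw [card_pairSYT emptySYT_mem_allSYT emptySYT_mem_allSYT (Nat.zero_le n) (Nat.zero_le n)]
  have h := numChainPairs_bot_mul_factorial (nu := ⊥) (n := n) (by rw [card_bot]; omega)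
  simpa [card_bot, numChains, emptySYT] using h

/-- For standard Young tableaux `A`, `B` of shapes `α ⊢ a`, `β ⊢ b`,
`|T_n(A,B)|/|T_n(∅,∅)| → f^α f^β/(a! b!)` as `n → ∞`. -/
theorem stmt15 {a b : ℕ} (α β : YoungDiagram) (hα : α.card = a) (hβ : β.card = b)
    (A : Fin (a + 1) → YoungDiagram) (hA : A ∈ skewSYT ⊥ α a)
    (B : Fin (b + 1) → YoungDiagram) (hB : B ∈ skewSYT ⊥ β b) :
    Filter.Tendsto (fun n : ℕ =>
        ((pairSYT n A B).card : ℝ) / ((pairSYT n emptySYT emptySYT).card : ℝ))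
      Filter.atTop
      (nhds ((((skewSYT ⊥ α a).card : ℝ) * ((skewSYT ⊥ β b).card : ℝ)) /
        ((a.factorial : ℝ) * (b.factorial : ℝ)))) := by
  have hA' := mem_skewSYT.1 hA
  have hB' := mem_skewSYT.1 hB
  subst hα hβ
  have h := tendsto_numChainPairs α β
  rw [card_skewSYT_bot, card_skewSYT_bot]
  refine h.congr' ?_
  filter_upwards [eventually_ge_atTop α.card, eventually_ge_atTop β.card] with n hn hn'
  rw [card_pairSYT_empty, card_pairSYT (mem_allSYT.2 ⟨hA'.1, hA'.2.2⟩)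
    (mem_allSYT.2 ⟨hB'.1, hB'.2.2⟩) hn hn', hA'.2.1, hB'.2.1]

end QT
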